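/- arXiv:0908.3618 — 2 statements merged into one kernel-verified Lean document; each statement's English description precedes it below -/
import Mathlib

section
/- If u solves the cylindrical Helmholtz equation with parameter k, then the function X₄u : (r,θ,z) ↦ sin θ · u_r(r,θ,z) + (cos θ / r) · u_θ(r,θ,z) also solves the cylindrical Helmholtz equation with parameter k on the region r > 0. (Infinitesimal invariance under the symmetry generator X₄ = sin θ ∂_r + (cos θ / r) ∂_θ of Theorem 1.) -/
/-- Partial derivative with respect to the first argument. -/
noncomputable def p1 (u : ℝ → ℝ → ℝ → ℝ) (r θ z : ℝ) : ℝ :=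
  deriv (fun s => u s θ z) r

/-- Partial derivative with respect to the second argument. -/
noncomputable def p2 (u : ℝ → ℝ → ℝ → ℝ) (r θ z : ℝ) : ℝ :=
  deriv (fun s => u r s z) θ

/-- Partial derivative with respect to the third argument. -/
noncomputable def p3 (u : ℝ → ℝ → ℝ → ℝ) (r θ z : ℝ) : ℝ :=
  deriv (fun s => u r θ s) z

/-- The cylindrical Helmholtz equation holds at the point `(r, θ, z)`:
`u_rr + (1/r)·u_r + (1/r²)·u_θθ + u_zz + k²·u = 0`. -/
def CHEat (k : ℝ) (u : ℝ → ℝ → ℝ → ℝ) (r θ z : ℝ) : Prop :=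
  p1 (p1 u) r θ z + (1 / r) * p1 u r θ z + (1 / r ^ 2) * p2 (p2 u) r θ z
    + p3 (p3 u) r θ z + k ^ 2 * u r θ z = 0

/-- `u` is a smooth function solving the cylindrical Helmholtz equation with
parameter `k` (at every point with `r > 0`). -/
def SolvesCHE (k : ℝ) (u : ℝ → ℝ → ℝ → ℝ) : Prop :=
  ContDiff ℝ (⊤ : ℕ∞) (fun p : ℝ × ℝ × ℝ => u p.1 p.2.1 p.2.2) ∧
    ∀ r θ z : ℝ, 0 < r → CHEat k u r θ z


def SmX (u : ℝ → ℝ → ℝ → ℝ) : Prop :=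
  ContDiff ℝ (⊤ : ℕ∞) (fun p : ℝ × ℝ × ℝ => u p.1 p.2.1 p.2.2)

theorem SmX.diff {u : ℝ → ℝ → ℝ → ℝ} (h : SmX u) :
    Differentiable ℝ (fun p : ℝ × ℝ × ℝ => u p.1 p.2.1 p.2.2) :=
  ContDiff.differentiable h (by simp)

theorem SmX.f1 {u : ℝ → ℝ → ℝ → ℝ} (h : SmX u) (r θ z : ℝ) :
    HasDerivAt (fun s => u s θ z)
      (fderiv ℝ (fun p : ℝ × ℝ × ℝ => u p.1 p.2.1 p.2.2) (r, θ, z) (1, 0, 0)) r :=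
  HasFDerivAt.comp_hasDerivAt (f := fun s : ℝ => (s, θ, z)) r (h.diff (r, θ, z)).hasFDerivAt
    ((hasDerivAt_id r).prodMk ((hasDerivAt_const r θ).prodMk (hasDerivAt_const r z)))

theorem SmX.f2 {u : ℝ → ℝ → ℝ → ℝ} (h : SmX u) (r θ z : ℝ) :
    HasDerivAt (fun s => u r s z)
      (fderiv ℝ (fun p : ℝ × ℝ × ℝ => u p.1 p.2.1 p.2.2) (r, θ, z) (0, 1, 0)) θ :=
  HasFDerivAt.comp_hasDerivAt (f := fun s : ℝ => (r, s, z)) θ (h.diff (r, θ, z)).hasFDerivAt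
    ((hasDerivAt_const θ r).prodMk ((hasDerivAt_id θ).prodMk (hasDerivAt_const θ z)))

theorem SmX.f3 {u : ℝ → ℝ → ℝ → ℝ} (h : SmX u) (r θ z : ℝ) :
    HasDerivAt (fun s => u r θ s)
      (fderiv ℝ (fun p : ℝ × ℝ × ℝ => u p.1 p.2.1 p.2.2) (r, θ, z) (0, 0, 1)) z :=
  HasFDerivAt.comp_hasDerivAt (f := fun s : ℝ => (r, θ, s)) z (h.diff (r, θ, z)).hasFDerivAt
    ((hasDerivAt_const z r).prodMk ((hasDerivAt_const z θ).prodMk (hasDerivAt_id z)))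

theorem SmX.e1 {u : ℝ → ℝ → ℝ → ℝ} (h : SmX u) :
    p1 u = fun r θ z =>
      fderiv ℝ (fun p : ℝ × ℝ × ℝ => u p.1 p.2.1 p.2.2) (r, θ, z) (1, 0, 0) := by
  funext r θ z; exact (h.f1 r θ z).deriv
theorem SmX.e2 {u : ℝ → ℝ → ℝ → ℝ} (h : SmX u) :
    p2 u = fun r θ z =>
      fderiv ℝ (fun p : ℝ × ℝ × ℝ => u p.1 p.2.1 p.2.2) (r, θ, z) (0, 1, 0) := by
  funext r θ z; exact (h.f2 r θ z).deriv
theorem SmX.e3 {u : ℝ → ℝ → ℝ → ℝ} (h : SmX u) :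
    p3 u = fun r θ z =>
      fderiv ℝ (fun p : ℝ × ℝ × ℝ => u p.1 p.2.1 p.2.2) (r, θ, z) (0, 0, 1) := by
  funext r θ z; exact (h.f3 r θ z).deriv

theorem SmX.d1 {u : ℝ → ℝ → ℝ → ℝ} (h : SmX u) (r θ z : ℝ) :
    HasDerivAt (fun s => u s θ z) (p1 u r θ z) r := by rw [h.e1]; exact h.f1 r θ z
theorem SmX.d2 {u : ℝ → ℝ → ℝ → ℝ} (h : SmX u) (r θ z : ℝ) :
    HasDerivAt (fun s => u r s z) (p2 u r θ z) θ := by rw [h.e2]; exact h.f2 r θ z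
theorem SmX.d3 {u : ℝ → ℝ → ℝ → ℝ} (h : SmX u) (r θ z : ℝ) :
    HasDerivAt (fun s => u r θ s) (p3 u r θ z) z := by rw [h.e3]; exact h.f3 r θ z

theorem SmX.sv {u : ℝ → ℝ → ℝ → ℝ} (h : SmX u) (v : ℝ × ℝ × ℝ) :
    SmX (fun r θ z => fderiv ℝ (fun p : ℝ × ℝ × ℝ => u p.1 p.2.1 p.2.2) (r, θ, z) v) :=
  (ContDiff.fderiv_right (m := (⊤ : ℕ∞)) h (by simp)).clm_apply contDiff_const

theorem SmX.s1 {u : ℝ → ℝ → ℝ → ℝ} (h : SmX u) : SmX (p1 u) := by rw [h.e1]; exact h.sv _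
theorem SmX.s2 {u : ℝ → ℝ → ℝ → ℝ} (h : SmX u) : SmX (p2 u) := by rw [h.e2]; exact h.sv _
theorem SmX.s3 {u : ℝ → ℝ → ℝ → ℝ} (h : SmX u) : SmX (p3 u) := by rw [h.e3]; exact h.sv _

theorem SmX.comm {u : ℝ → ℝ → ℝ → ℝ} (h : SmX u) (v w x : ℝ × ℝ × ℝ) :
    fderiv ℝ (fun p : ℝ × ℝ × ℝ =>
      fderiv ℝ (fun p : ℝ × ℝ × ℝ => u p.1 p.2.1 p.2.2) (p.1, p.2.1, p.2.2) v) x w =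
    fderiv ℝ (fun p : ℝ × ℝ × ℝ =>
      fderiv ℝ (fun p : ℝ × ℝ × ℝ => u p.1 p.2.1 p.2.2) (p.1, p.2.1, p.2.2) w) x v := by
  have hs : IsSymmSndFDerivAt ℝ (fun p : ℝ × ℝ × ℝ => u p.1 p.2.1 p.2.2) x :=
    (ContDiff.contDiffAt h).isSymmSndFDerivAt (by
      simp only [minSmoothness_of_isRCLikeNormedField]; exact WithTop.coe_le_coe.2 (le_top (a := (2 : ℕ∞))))
  have hd : DifferentiableAt ℝ (fderiv ℝ (fun p : ℝ × ℝ × ℝ => u p.1 p.2.1 p.2.2)) x :=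
    (ContDiff.fderiv_right (m := (⊤ : ℕ∞)) h (by simp)).differentiable (by simp) x
  have key : ∀ v w, fderiv ℝ (fun p : ℝ × ℝ × ℝ =>
      fderiv ℝ (fun p : ℝ × ℝ × ℝ => u p.1 p.2.1 p.2.2) p v) x w =
      fderiv ℝ (fderiv ℝ (fun p : ℝ × ℝ × ℝ => u p.1 p.2.1 p.2.2)) x w v := by
    intro v w
    rw [fderiv_clm_apply hd (differentiableAt_const v)]
    simp
  exact (key v w).trans ((hs.eq w v).trans (key w v).symm)

theorem SmX.c21 {u : ℝ → ℝ → ℝ → ℝ} (h : SmX u) : p2 (p1 u) = p1 (p2 u) := by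
  rw [h.s1.e2, h.s2.e1, h.e1, h.e2]; funext r θ z; exact h.comm _ _ _
theorem SmX.c31 {u : ℝ → ℝ → ℝ → ℝ} (h : SmX u) : p3 (p1 u) = p1 (p3 u) := by
  rw [h.s1.e3, h.s3.e1, h.e1, h.e3]; funext r θ z; exact h.comm _ _ _
theorem SmX.c32 {u : ℝ → ℝ → ℝ → ℝ} (h : SmX u) : p3 (p2 u) = p2 (p3 u) := by
  rw [h.s2.e3, h.s3.e2, h.e2, h.e3]; funext r θ z; exact h.comm _ _ _

/-- Infinitesimal invariance under `X₄ = sin θ ∂_r + (cos θ / r) ∂_θ`: if `u`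
solves the cylindrical Helmholtz equation with parameter `k`, then so does
`X₄u = sin θ · u_r + (cos θ / r) · u_θ` on the region `r > 0`. -/
theorem che_X4_infinitesimal_symmetry (k : ℝ) (u : ℝ → ℝ → ℝ → ℝ)
    (hu : SolvesCHE k u) :
    ∀ r θ z : ℝ, 0 < r →
      CHEat k (fun r θ z =>
        Real.sin θ * p1 u r θ z + (Real.cos θ / r) * p2 u r θ z) r θ z := by
  intro r θ z hr
  obtain ⟨hs, he⟩ := hu
  have h : SmX u := hs
  have hr0 : r ≠ 0 := hr.ne'
  have hinv : ∀ s : ℝ, 0 < s → HasDerivAt (fun s : ℝ => 1 / s) (-(1 / s ^ 2)) s := by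
    intro s hs0
    simpa using hasDerivAt_inv hs0.ne'
  have hinv2 : ∀ s : ℝ, 0 < s → HasDerivAt (fun s : ℝ => 1 / s ^ 2) (-(2 / s ^ 3)) s := by
    intro s hs0
    have h1 := (hasDerivAt_pow 2 s).fun_inv (pow_ne_zero 2 hs0.ne')
    simp only [one_div]
    refine h1.congr_deriv ?_
    have := hs0.ne'
    norm_num
    field_simp
  -- differentiated equations
  have E1 : p1 (p1 (p1 u)) r θ z + (-(1 / r ^ 2) * p1 u r θ z + 1 / r * p1 (p1 u) r θ z)
      + (-(2 / r ^ 3) * p2 (p2 u) r θ z + 1 / r ^ 2 * p1 (p2 (p2 u)) r θ z)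
      + p1 (p3 (p3 u)) r θ z + k ^ 2 * p1 u r θ z = 0 := by
    have hd := ((((h.s1.s1.d1 r θ z).add ((hinv r hr).mul (h.s1.d1 r θ z))).add
      ((hinv2 r hr).mul (h.s2.s2.d1 r θ z))).add (h.s3.s3.d1 r θ z)).add
      ((h.d1 r θ z).const_mul (k ^ 2))
    refine hd.unique ((hasDerivAt_const r (0 : ℝ)).congr_of_eventuallyEq ?_)
    filter_upwards [lt_mem_nhds hr] with s hs0
    exact he s θ z hs0
  have E2 : p2 (p1 (p1 u)) r θ z + 1 / r * p2 (p1 u) r θ z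
      + 1 / r ^ 2 * p2 (p2 (p2 u)) r θ z
      + p2 (p3 (p3 u)) r θ z + k ^ 2 * p2 u r θ z = 0 := by
    have hd := ((((h.s1.s1.d2 r θ z).add ((h.s1.d2 r θ z).const_mul (1 / r))).add
      ((h.s2.s2.d2 r θ z).const_mul (1 / r ^ 2))).add (h.s3.s3.d2 r θ z)).add
      ((h.d2 r θ z).const_mul (k ^ 2))
    refine hd.unique ((hasDerivAt_const θ (0 : ℝ)).congr_of_eventuallyEq ?_)
    exact Filter.Eventually.of_forall fun s => he r s z hr
  have E0 := he r θ z hr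
  unfold CHEat at E0 ⊢
  set W : ℝ → ℝ → ℝ → ℝ := fun r θ z =>
        Real.sin θ * p1 u r θ z + (Real.cos θ / r) * p2 u r θ z with hW
  have W1 : ∀ s, 0 < s → p1 W s θ z = Real.sin θ * p1 (p1 u) s θ z
      + Real.cos θ * (-(1 / s ^ 2) * p2 u s θ z + 1 / s * p1 (p2 u) s θ z) := by
    intro s hs0
    have hd := ((h.s1.d1 s θ z).const_mul (Real.sin θ)).add
      (((hinv s hs0).mul (h.s2.d1 s θ z)).const_mul (Real.cos θ))
    refine HasDerivAt.deriv (hd.congr_of_eventuallyEq ?_)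
    refine Filter.Eventually.of_forall fun t => ?_
    simp [hW]; ring
  have W11 : p1 (p1 W) r θ z = Real.sin θ * p1 (p1 (p1 u)) r θ z
      + Real.cos θ * ((2 / r ^ 3 * p2 u r θ z + -(1 / r ^ 2) * p1 (p2 u) r θ z) +
        (-(1 / r ^ 2) * p1 (p2 u) r θ z + 1 / r * p1 (p1 (p2 u)) r θ z)) := by
    have hd := ((h.s1.s1.d1 r θ z).const_mul (Real.sin θ)).add
      ((((hinv2 r hr).neg.mul (h.s2.d1 r θ z)).add
        ((hinv r hr).mul (h.s2.s1.d1 r θ z))).const_mul (Real.cos θ))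
    rw [neg_neg] at hd
    refine HasDerivAt.deriv (hd.congr_of_eventuallyEq ?_)
    filter_upwards [lt_mem_nhds hr] with s hs0
    exact W1 s hs0
  have W2 : ∀ t, p2 W r t z = (Real.cos t * p1 u r t z + Real.sin t * p2 (p1 u) r t z)
      + (-Real.sin t / r * p2 u r t z + Real.cos t / r * p2 (p2 u) r t z) := by
    intro t
    exact HasDerivAt.deriv (((Real.hasDerivAt_sin t).mul (h.s1.d2 r t z)).add
      (((Real.hasDerivAt_cos t).div_const r).mul (h.s2.d2 r t z)))
  have W22 : p2 (p2 W) r θ z =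
      ((-Real.sin θ * p1 u r θ z + Real.cos θ * p2 (p1 u) r θ z)
        + (Real.cos θ * p2 (p1 u) r θ z + Real.sin θ * p2 (p2 (p1 u)) r θ z))
      + ((-Real.cos θ / r * p2 u r θ z + -Real.sin θ / r * p2 (p2 u) r θ z)
        + (-Real.sin θ / r * p2 (p2 u) r θ z + Real.cos θ / r * p2 (p2 (p2 u)) r θ z)) := by
    have hd := (((Real.hasDerivAt_cos θ).mul (h.s1.d2 r θ z)).add
        ((Real.hasDerivAt_sin θ).mul (h.s1.s2.d2 r θ z))).add
      ((((Real.hasDerivAt_sin θ).neg.div_const r).mul (h.s2.d2 r θ z)).add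
      (((Real.hasDerivAt_cos θ).div_const r).mul (h.s2.s2.d2 r θ z)))
    refine HasDerivAt.deriv (hd.congr_of_eventuallyEq ?_)
    exact Filter.Eventually.of_forall W2
  have W3 : ∀ t, p3 W r θ t = Real.sin θ * p3 (p1 u) r θ t
      + Real.cos θ / r * p3 (p2 u) r θ t := fun t =>
    HasDerivAt.deriv (((h.s1.d3 r θ t).const_mul _).add ((h.s2.d3 r θ t).const_mul _))
  have W33 : p3 (p3 W) r θ z = Real.sin θ * p3 (p3 (p1 u)) r θ z
      + Real.cos θ / r * p3 (p3 (p2 u)) r θ z := by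
    have hd := ((h.s1.s3.d3 r θ z).const_mul (Real.sin θ)).add
      ((h.s2.s3.d3 r θ z).const_mul (Real.cos θ / r))
    refine HasDerivAt.deriv (hd.congr_of_eventuallyEq ?_)
    exact Filter.Eventually.of_forall W3
  rw [W11, W1 r hr, W22, W33]
  simp only [h.c21, h.c31, h.c32, h.s1.c21, h.s2.c21, h.s3.c31, h.s3.c32] at E1 E2 ⊢
  simp only [hW]
  linear_combination (exp := 1) Real.sin θ * E1 + Real.cos θ / r * E2
end

section
/- The bilinear antisymmetric bracket on ℝ⁷ determined on the standard basis e₁,…,e₇ by [e₁,e₄] = −e₅, [e₁,e₅] = e₄, [e₁,e₆] = e₇, [e₁,e₇] = −e₆, [e₂,e₆] = e₅, [e₂,e₇] = e₄, [e₄,e₇] = −e₂, [e₅,e₆] = −e₂, [e₆,e₇] = e₁, and all other brackets of basis elements equal to zero, satisfies the Jacobi identity; hence it makes ℝ⁷ into a real Lie algebra 𝔤 (the symmetry algebra of the cylindrical Helmholtz equation, Theorem 1). -/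
/-- The bilinear extension to `ℝ⁷` of the bracket given on the standard basis by
`[e₁,e₄] = −e₅`, `[e₁,e₅] = e₄`, `[e₁,e₆] = e₇`, `[e₁,e₇] = −e₆`, `[e₂,e₆] = e₅`,
`[e₂,e₇] = e₄`, `[e₄,e₇] = −e₂`, `[e₅,e₆] = −e₂`, `[e₆,e₇] = e₁`, all other
brackets of basis elements zero (indices shifted down by one, so `eᵢ` has index
`i - 1`). -/
def gBracket (v w : Fin 7 → ℝ) : Fin 7 → ℝ :=
  ![v 5 * w 6 - v 6 * w 5,
    -(v 3 * w 6 - v 6 * w 3) - (v 4 * w 5 - v 5 * w 4),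
    0,
    (v 0 * w 4 - v 4 * w 0) + (v 1 * w 6 - v 6 * w 1),
    -(v 0 * w 3 - v 3 * w 0) + (v 1 * w 5 - v 5 * w 1),
    -(v 0 * w 6 - v 6 * w 0),
    v 0 * w 5 - v 5 * w 0]

/-- The standard basis vector `eᵢ₊₁` of `ℝ⁷` (so `e 0 = e₁`, …, `e 6 = e₇`). -/
def e (i : Fin 7) : Fin 7 → ℝ := Pi.single i 1

/-- The pairs of (zero-based) indices carrying a nonzero bracket. -/
def nonzeroPairs : Set (Fin 7 × Fin 7) :=
  {(0, 3), (0, 4), (0, 5), (0, 6), (1, 5), (1, 6), (3, 6), (4, 5), (5, 6)}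

set_option maxHeartbeats 4000000 in
/-- The bracket on `ℝ⁷` determined on the standard basis by
`[e₁,e₄] = −e₅`, `[e₁,e₅] = e₄`, `[e₁,e₆] = e₇`, `[e₁,e₇] = −e₆`, `[e₂,e₆] = e₅`,
`[e₂,e₇] = e₄`, `[e₄,e₇] = −e₂`, `[e₅,e₆] = −e₂`, `[e₆,e₇] = e₁` and all other
brackets of basis elements zero, is bilinear, antisymmetric and satisfies the
Jacobi identity; hence it makes `ℝ⁷` into a real Lie algebra. -/
theorem gBracket_lie_algebra :
    -- bilinearity
    (∀ (a : ℝ) (x x' y : Fin 7 → ℝ),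
        gBracket (a • x + x') y = a • gBracket x y + gBracket x' y) ∧
    (∀ (a : ℝ) (x y y' : Fin 7 → ℝ),
        gBracket x (a • y + y') = a • gBracket x y + gBracket x y') ∧
    -- antisymmetry
    (∀ x y : Fin 7 → ℝ, gBracket x y = -gBracket y x) ∧
    -- values on the standard basis
    gBracket (e 0) (e 3) = -e 4 ∧
    gBracket (e 0) (e 4) = e 3 ∧
    gBracket (e 0) (e 5) = e 6 ∧
    gBracket (e 0) (e 6) = -e 5 ∧
    gBracket (e 1) (e 5) = e 4 ∧
    gBracket (e 1) (e 6) = e 3 ∧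
    gBracket (e 3) (e 6) = -e 1 ∧
    gBracket (e 4) (e 5) = -e 1 ∧
    gBracket (e 5) (e 6) = e 0 ∧
    (∀ i j : Fin 7, (i, j) ∉ nonzeroPairs → (j, i) ∉ nonzeroPairs →
        gBracket (e i) (e j) = 0) ∧
    -- the Jacobi identity
    (∀ x y z : Fin 7 → ℝ,
        gBracket x (gBracket y z) + gBracket y (gBracket z x)
          + gBracket z (gBracket x y) = 0) := by
  refine ⟨?_, ?_, ?_, ?_, ?_, ?_, ?_, ?_, ?_, ?_, ?_, ?_, ?_, ?_⟩
  · intro a x x' y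
    ext k
    fin_cases k <;> simp [gBracket] <;> ring
  · intro a x y y'
    ext k
    fin_cases k <;> simp [gBracket] <;> ring
  · intro x y
    ext k
    fin_cases k <;> simp [gBracket] <;> ring
  iterate 9
    · ext k
      fin_cases k <;> simp [gBracket, e, Pi.single_apply]
  · intro i j h1 h2
    ext k
    fin_cases i <;> fin_cases j <;> first
      | (exfalso; simp [nonzeroPairs] at h1; done)
      | (exfalso; simp [nonzeroPairs] at h2; done)
      | (clear h1 h2; fin_cases k <;> simp [gBracket, e, Pi.single_apply])
  · intro x y z
    ext k
    fin_cases k <;> simp [gBracket] <;> ring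
end
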